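/- Let A=(C,m) be a 3-dimensional toric idealistic cluster with nodes Q_1,…,Q_r, and let Q_j be a node with χ_j > 0. Then Σ_{i: 1 ≤ i ≤ r, N_j | N_i} χ_i > 0. (Via A'Campo's formula this says that e^{2πi/N_j} is an eigenvalue of the local monodromy of a surface general for the cluster, so N_j is the order of an eigenvalue of monodromy.) -/

import Mathlib

open Finset

/-!
Common framework: 3-dimensional toric constellations and toric idealistic clusters.
The edge labels `1, 2, 3` of the paper are encoded as `0, 1, 2 : Fin 3`.
-/

/-- A 3-dimensional toric constellation: a finite rooted tree on nodes `0, …, r−1`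
(node `0` the root, every child having larger index than its parent), each node having
at most three children, the edges from a node to its children carrying pairwise
distinct labels in `Fin 3`.  `label j` is the label of the edge from `parent j` to `j`
(irrelevant for the root). -/
structure ToricConstellation (r : ℕ) where
  parent : Fin r → Fin r
  label : Fin r → Fin 3
  parent_lt : ∀ i : Fin r, 0 < (i : ℕ) → (parent i : ℕ) < (i : ℕ)
  parent_root : ∀ i : Fin r, (i : ℕ) = 0 → parent i = i
  label_distinct : ∀ i j : Fin r, 0 < (i : ℕ) → 0 < (j : ℕ) → i ≠ j →
    parent i = parent j → label i ≠ label j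

namespace ToricConstellation

variable {r : ℕ}

/-- The ordered triple of vectors of `ℤ³` attached to a node: the root carries the
standard basis, and the child along the edge labelled `a` of a node with cone
`(u₁,u₂,u₃)` carries the triple obtained by replacing `u_a` with `u₁+u₂+u₃`. -/
def cone (C : ToricConstellation r) (i : Fin r) : Fin 3 → (Fin 3 → ℤ) :=
  if h : 0 < (i : ℕ) then
    Function.update (cone C (C.parent i)) (C.label i) (∑ a, cone C (C.parent i) a)
  else fun a => Pi.single a 1
termination_by (i : ℕ)
decreasing_by all_goals exact C.parent_lt i h

/-- `v(Q) = u₁ + u₂ + u₃`, the sum of the cone vectors of a node. -/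
def v (C : ToricConstellation r) (i : Fin r) : Fin 3 → ℤ := ∑ a, cone C i a

/-- `Prox C j i` means `j → i`, i.e. `Q_j` is proximate to `Q_i`:
`j ≠ i` and `v(Q_i)` is an entry of `cone(Q_j)`. -/
def Prox (C : ToricConstellation r) (j i : Fin r) : Prop :=
  j ≠ i ∧ ∃ a : Fin 3, cone C j a = v C i

instance (C : ToricConstellation r) (j i : Fin r) : Decidable (C.Prox j i) := by
  unfold Prox; infer_instance

/-- `inChain C i a b j = true` iff `j = Q_i(a, b^t)` for some `t ≥ 0`, i.e. `j` is
reached from `i` by one edge labelled `a` followed by `t` edges labelled `b`. -/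
def inChain (C : ToricConstellation r) (i : Fin r) (a b : Fin 3) (j : Fin r) : Bool :=
  if h : 0 < (j : ℕ) then
    (decide (C.parent j = i) && decide (C.label j = a)) ||
      (decide (C.label j = b) && inChain C i a b (C.parent j))
  else false
termination_by (j : ℕ)
decreasing_by exact C.parent_lt j h

/-- `LinProx C j i` means `j ↠ i`, i.e. `Q_j` is linearly proximate to `Q_i`. -/
def LinProx (C : ToricConstellation r) (j i : Fin r) : Prop :=
  ∃ a b : Fin 3, a ≠ b ∧ inChain C i a b j = true

instance (C : ToricConstellation r) (j i : Fin r) : Decidable (C.LinProx j i) := by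
  unfold LinProx; infer_instance

/-- `j` is a child of `i`. -/
def IsChild (C : ToricConstellation r) (j i : Fin r) : Prop :=
  0 < (j : ℕ) ∧ C.parent j = i

instance (C : ToricConstellation r) (j i : Fin r) : Decidable (C.IsChild j i) := by
  unfold IsChild; infer_instance

/-- The set `S_i` of labels of the edges on the path from the root to `Q_i`. -/
def labelsUnder (C : ToricConstellation r) (i : Fin r) : Finset (Fin 3) :=
  if h : 0 < (i : ℕ) then insert (C.label i) (labelsUnder C (C.parent i)) else ∅
termination_by (i : ℕ)
decreasing_by exact C.parent_lt i h

/-- `i` is a weak ancestor of `j` (`i = j` or `i` a strict ancestor of `j`). -/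
def anc (C : ToricConstellation r) (i j : Fin r) : Bool :=
  decide (i = j) || (if h : 0 < (j : ℕ) then anc C i (C.parent j) else false)
termination_by (j : ℕ)
decreasing_by exact C.parent_lt j h

/-- The set of nodes weakly above `i` (`i` together with its descendants). -/
def weakAbove (C : ToricConstellation r) (i : Fin r) : Finset (Fin r) :=
  univ.filter (fun j => anc C i j = true)

end ToricConstellation

/-- A 3-dimensional toric cluster: a toric constellation together with a positive
integer weight for each node. -/
structure ToricCluster (r : ℕ) extends ToricConstellation r where
  m : Fin r → ℤ
  m_pos : ∀ j, 0 < m j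

namespace ToricCluster

open ToricConstellation

variable {r : ℕ}

/-- `M_{Q_i}(a,b) := Σ_{t ≥ 0, Q_i(a,b^t) ∈ C} m_{Q_i(a,b^t)}`. -/
def M (A : ToricCluster r) (i : Fin r) (a b : Fin 3) : ℤ :=
  ∑ j ∈ univ.filter (fun j => inChain A.toToricConstellation i a b j = true), A.m j

/-- The cluster is idealistic: the linear proximity inequalities
`M_{Q_i}(a,b) + M_{Q_i}(b,a) ≤ m_{Q_i}` hold. -/
def Idealistic (A : ToricCluster r) : Prop :=
  ∀ i : Fin r, ∀ a b : Fin 3, a ≠ b → A.M i a b + A.M i b a ≤ A.m i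

/-- The set of nodes `j` proximate to `i` (`j → i`). -/
def proxSet (A : ToricCluster r) (i : Fin r) : Finset (Fin r) :=
  univ.filter (fun j => Prox A.toToricConstellation j i)

/-- `B_i`: the set of nodes to which `i` is proximate. -/
def Bset (A : ToricCluster r) (i : Fin r) : Finset (Fin r) :=
  univ.filter (fun j => Prox A.toToricConstellation i j)

/-- `A_i`: the children `k` of `i` for which there is no `l` with `i → l` and `k → l`. -/
def Aset (A : ToricCluster r) (i : Fin r) : Finset (Fin r) :=
  univ.filter (fun k => IsChild A.toToricConstellation k i ∧
    ¬ ∃ l, Prox A.toToricConstellation i l ∧ Prox A.toToricConstellation k l)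

/-- The Euler characteristic `χ_i = χ(E_i°)`. -/
def chi (A : ToricCluster r) (i : Fin r) : ℤ :=
  3 + A.m i * (A.m i - 3)
    - ∑ j ∈ A.proxSet i, A.m j * (A.m j - 1)
    + ∑ j ∈ A.proxSet i,
        (A.m j - ∑ k ∈ (A.proxSet i).filter
          (fun k => LinProx A.toToricConstellation k j), A.m k)
    + ∑ j ∈ A.Bset i,
        (A.m i - ∑ k ∈ (A.proxSet j).filter
          (fun k => LinProx A.toToricConstellation k i), A.m k)
    - ((A.Aset i).card : ℤ) - 2 * ((A.Bset i).card : ℤ)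
    + (((A.Bset i).card.choose 2 : ℕ) : ℤ)

/-- `D_i = m_i² − Σ_{j→i} m_j²`. -/
def D (A : ToricCluster r) (i : Fin r) : ℤ :=
  A.m i ^ 2 - ∑ j ∈ A.proxSet i, A.m j ^ 2

/-- `r_{ab} = m_i − M_{Q_i}(a,b) − M_{Q_i}(b,a)`. -/
def rab (A : ToricCluster r) (i : Fin r) (a b : Fin 3) : ℤ :=
  A.m i - A.M i a b - A.M i b a

/-- `R_i = r̂_{12} + r̂_{13} + r̂_{23}`, where `r̂_{ab} = r_{ab}` if the remaining third
label does not appear under `Q_i`, and `r̂_{ab} = 0` otherwise.  (Labels `1,2,3` are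
encoded as `0,1,2 : Fin 3`.) -/
def R (A : ToricCluster r) (i : Fin r) : ℤ :=
  (if (2 : Fin 3) ∉ labelsUnder A.toToricConstellation i then A.rab i 0 1 else 0)
  + (if (1 : Fin 3) ∉ labelsUnder A.toToricConstellation i then A.rab i 0 2 else 0)
  + (if (0 : Fin 3) ∉ labelsUnder A.toToricConstellation i then A.rab i 1 2 else 0)

/-- `T_i = 3 − #A_i − 2·#B_i + (#B_i choose 2)`. -/
def T (A : ToricCluster r) (i : Fin r) : ℤ :=
  3 - ((A.Aset i).card : ℤ) - 2 * ((A.Bset i).card : ℤ)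
    + (((A.Bset i).card.choose 2 : ℕ) : ℤ)

/-- The nodes to which `i` is proximate, of smaller index: the sums in the recursive
definitions of the numerical data range over the nodes to which `i` is proximate,
which are ancestors of `i` and hence have smaller index (making the recursion
well-founded). -/
def anteSet (A : ToricCluster r) (i : Fin r) : Finset (Fin r) :=
  univ.filter (fun j => (j : ℕ) < (i : ℕ) ∧ Prox A.toToricConstellation i j)

/-- The numerical datum `N_i := m_i + Σ_{j : i→j} N_j`. -/
def N (A : ToricCluster r) (i : Fin r) : ℤ :=
  A.m i + ∑ j ∈ (A.anteSet i).attach, N A j.1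
termination_by (i : ℕ)
decreasing_by
  have hj := j.2
  simp only [anteSet, Finset.mem_filter] at hj
  exact hj.2.1

/-- The numerical datum `ν_i := 3 + Σ_{j : i→j} (ν_j − 1)`. -/
def nu (A : ToricCluster r) (i : Fin r) : ℤ :=
  3 + ∑ j ∈ (A.anteSet i).attach, (nu A j.1 - 1)
termination_by (i : ℕ)
decreasing_by
  have hj := j.2
  simp only [anteSet, Finset.mem_filter] at hj
  exact hj.2.1

end ToricCluster


open ToricConstellation ToricCluster


namespace ToricConstellation

variable {r : ℕ} (C : ToricConstellation r)

/-- The labels on the path from a node down to the root, the last edge coming first. -/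
def word (i : Fin r) : List (Fin 3) :=
  if h : 0 < (i : ℕ) then C.label i :: word (C.parent i) else []
termination_by (i : ℕ)
decreasing_by exact C.parent_lt i h

theorem word_of_pos {i : Fin r} (h : 0 < (i : ℕ)) :
    C.word i = C.label i :: C.word (C.parent i) := by
  rw [word, dif_pos h]

theorem word_of_not_pos {i : Fin r} (h : ¬ 0 < (i : ℕ)) : C.word i = [] := by
  rw [word, dif_neg h]

theorem word_eq_cons {i : Fin r} {a : Fin 3} {q : List (Fin 3)} (h : C.word i = a :: q) :
    0 < (i : ℕ) ∧ C.label i = a ∧ C.word (C.parent i) = q := by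
  by_cases hi : 0 < (i : ℕ)
  · rw [C.word_of_pos hi, List.cons.injEq] at h
    exact ⟨hi, h⟩
  · rw [C.word_of_not_pos hi] at h
    cases h

theorem word_injective : Function.Injective C.word := by
  suffices ∀ n, ∀ i j : Fin r, (i : ℕ) = n → C.word i = C.word j → i = j from
    fun i j h => this _ i j rfl h
  intro n
  induction n using Nat.strong_induction_on with
  | _ n ih =>
    intro i j hn h
    by_cases hi : 0 < (i : ℕ)
    · rw [C.word_of_pos hi] at h
      obtain ⟨hj, hl, hp⟩ := C.word_eq_cons h.symm
      by_contra hij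
      exact C.label_distinct i j hi hj hij
        (ih _ (hn ▸ C.parent_lt i hi) _ _ rfl hp.symm) hl.symm
    · by_cases hj : 0 < (j : ℕ)
      · rw [C.word_of_not_pos hi, C.word_of_pos hj] at h
        cases h
      · exact Fin.ext (by omega)

theorem exists_word_eq_of_append (w q : List (Fin 3)) {i : Fin r} (h : C.word i = w ++ q) :
    ∃ j, C.word j = q := by
  induction w generalizing i with
  | nil => exact ⟨i, h⟩
  | cons a w ih => exact ih (C.word_eq_cons h).2.2

theorem lt_of_word_eq_append {w : List (Fin 3)} {a : Fin 3} {i j : Fin r}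
    (h : C.word i = w ++ a :: C.word j) : (j : ℕ) < (i : ℕ) := by
  induction w generalizing i with
  | nil =>
    obtain ⟨hi, -, hp⟩ := C.word_eq_cons h
    exact C.word_injective hp ▸ C.parent_lt i hi
  | cons b w ih =>
    obtain ⟨hi, -, hp⟩ := C.word_eq_cons h
    exact (ih hp).trans (C.parent_lt i hi)

/-- The cone reached from the standard basis along a word (last edge first). -/
def wordCone : List (Fin 3) → Fin 3 → Fin 3 → ℤ
  | [] => fun a => Pi.single a 1
  | a :: q => Function.update (wordCone q) a (∑ b, wordCone q b)

theorem cone_eq_wordCone (i : Fin r) : C.cone i = wordCone (C.word i) := by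
  suffices ∀ n, ∀ i : Fin r, (i : ℕ) = n → C.cone i = wordCone (C.word i) from this _ i rfl
  intro n
  induction n using Nat.strong_induction_on with
  | _ n ih =>
    intro i hn
    by_cases hi : 0 < (i : ℕ)
    · rw [cone, dif_pos hi, C.word_of_pos hi, wordCone,
        ih _ (hn ▸ C.parent_lt i hi) _ rfl]
    · rw [cone, dif_neg hi, C.word_of_not_pos hi, wordCone]

theorem wordCone_nonneg (q : List (Fin 3)) (a b : Fin 3) : 0 ≤ wordCone q a b := by
  induction q generalizing a with
  | nil => by_cases h : b = a <;> simp [wordCone, h]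
  | cons c q ih =>
    by_cases h : a = c
    · subst h
      simpa [wordCone] using Finset.sum_nonneg fun x _ => ih x
    · simpa [wordCone, h] using ih a

theorem sum_wordCone_pos (q : List (Fin 3)) (b : Fin 3) : 0 < (∑ a, wordCone q a) b := by
  induction q with
  | nil => simp [wordCone, Pi.single_apply]
  | cons c q ih =>
    refine ih.trans_le ?_
    rw [Finset.sum_apply b univ (wordCone (c :: q))]
    refine le_trans (le_of_eq ?_)
      (Finset.single_le_sum (fun x _ => wordCone_nonneg (c :: q) x b) (mem_univ c))
    simp [wordCone]

theorem wordCone_append_singleton (q : List (Fin 3)) (a x y : Fin 3) :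
    wordCone (q ++ [a]) x y = wordCone q x y + if y = a then 0 else wordCone q x a := by
  induction q generalizing x with
  | nil =>
    fin_cases a <;> fin_cases x <;> fin_cases y <;>
      simp [wordCone, Fin.sum_univ_three]
  | cons c q ih =>
    by_cases h : x = c
    · subst h
      by_cases hy : y = a
      · subst hy
        simp [wordCone, ih]
      · simp [wordCone, ih, hy, Finset.sum_add_distrib]
    · simp [wordCone, h, ih]

theorem sum_wordCone_append_singleton (q : List (Fin 3)) (a y : Fin 3) :
    (∑ x, wordCone (q ++ [a]) x) y =
      (∑ x, wordCone q x) y + if y = a then 0 else (∑ x, wordCone q x) a := by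
  by_cases hy : y = a <;>
    simp [wordCone_append_singleton, hy, Finset.sum_add_distrib]

theorem sum_wordCone_injective {p q : List (Fin 3)}
    (h : ∑ a, wordCone p a = ∑ a, wordCone q a) : p = q := by
  have key : ∀ (q : List (Fin 3)) (a : Fin 3), ∀ y ≠ a,
      (∑ x, wordCone (q ++ [a]) x) a < (∑ x, wordCone (q ++ [a]) x) y := by
    intro q a y hy
    rw [sum_wordCone_append_singleton, sum_wordCone_append_singleton, if_pos rfl, if_neg hy]
    linarith [sum_wordCone_pos q y]
  have hnil : ∀ x y : Fin 3, (∑ a, wordCone [] a) x = (∑ a, wordCone [] a) y := by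
    intro x y
    simp [wordCone, Pi.single_apply]
  have hne : ∀ a : Fin 3, ∃ y, y ≠ a := by decide
  induction p using List.reverseRecOn generalizing q with
  | nil =>
    rcases List.eq_nil_or_concat q with rfl | ⟨q, b, rfl⟩
    · rfl
    · obtain ⟨y, hy⟩ := hne b
      have := key q b y hy
      rw [List.concat_eq_append] at h
      rw [← h, hnil b y] at this
      exact absurd this (lt_irrefl _)
  | append_singleton p a ih =>
    rcases List.eq_nil_or_concat q with rfl | ⟨q, b, rfl⟩
    · obtain ⟨y, hy⟩ := hne a
      have := key p a y hy
      rw [h, hnil a y] at this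
      exact absurd this (lt_irrefl _)
    · rw [List.concat_eq_append] at h ⊢
      have hab : a = b := by
        by_contra hab
        have h1 := key p a b (Ne.symm hab)
        have h2 := key q b a hab
        rw [h] at h1
        exact absurd (h1.trans h2) (lt_irrefl _)
      subst hab
      have ha : (∑ x, wordCone p x) a = (∑ x, wordCone q x) a := by
        have := congrFun h a
        simpa only [sum_wordCone_append_singleton, if_true, add_zero] using this
      rw [ih]
      funext y
      have := congrFun h y
      rw [sum_wordCone_append_singleton, sum_wordCone_append_singleton, ha] at this
      exact add_right_cancel this

/-- `Extends P p q` means that the word `p` is obtained from `q` by adding letters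
satisfying `P`. -/
def Extends (P : Fin 3 → Prop) (p q : List (Fin 3)) : Prop :=
  ∃ w, (∀ y ∈ w, P y) ∧ p = w ++ q

theorem extends_cons_left {P : Fin 3 → Prop} {p q : List (Fin 3)} {d : Fin 3} :
    Extends P (d :: p) q ↔ d :: p = q ∨ (P d ∧ Extends P p q) := by
  constructor
  · rintro ⟨w, hw, h⟩
    cases w with
    | nil => exact Or.inl h
    | cons e w =>
      rw [List.cons_append, List.cons.injEq] at h
      refine Or.inr ⟨h.1 ▸ hw e (by simp), w, fun y hy => hw y (by simp [hy]), h.2⟩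
  · rintro (rfl | ⟨hd, w, hw, rfl⟩)
    · exact ⟨[], by simp, rfl⟩
    · exact ⟨d :: w, by simpa using ⟨hd, hw⟩, rfl⟩

theorem extends_iff {P : Fin 3 → Prop} {p q : List (Fin 3)} :
    Extends P p q ↔ p = q ∨ ∃ d, P d ∧ Extends P p (d :: q) := by
  constructor
  · rintro ⟨w, hw, rfl⟩
    rcases List.eq_nil_or_concat w with rfl | ⟨w, d, rfl⟩
    · exact Or.inl rfl
    · exact Or.inr ⟨d, hw d (by simp), w, fun y hy => hw y (by simp [hy]), by simp⟩
  · rintro (rfl | ⟨d, hd, w, hw, rfl⟩)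
    · exact ⟨[], by simp, rfl⟩
    · exact ⟨w ++ [d], by simpa [or_imp, forall_and] using ⟨hw, hd⟩, by simp⟩

theorem append_cons_inj {w w' q : List (Fin 3)} {d e : Fin 3}
    (h : w ++ d :: q = w' ++ e :: q) : w = w' ∧ d = e := by
  obtain ⟨h1, h2⟩ := List.append_inj' h (by simp)
  exact ⟨h1, (List.cons.inj h2).1⟩

theorem Extends.label_unique {P P' : Fin 3 → Prop} {p q : List (Fin 3)} {d e : Fin 3}
    (h : Extends P p (d :: q)) (h' : Extends P' p (e :: q)) : d = e := by
  obtain ⟨w, -, hw⟩ := h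
  obtain ⟨w', -, hw'⟩ := h'
  exact (append_cons_inj (hw ▸ hw')).2

theorem not_extends_cons_self {P : Fin 3 → Prop} {q : List (Fin 3)} {d : Fin 3} :
    ¬ Extends P q (d :: q) := by
  rintro ⟨w, -, h⟩
  have := congrArg List.length h
  simp only [List.length_append, List.length_cons] at this
  omega

theorem wordCone_eq_iff {p q : List (Fin 3)} {a : Fin 3} :
    wordCone p a = ∑ b, wordCone q b ↔ Extends (· ≠ a) p (a :: q) := by
  induction p with
  | nil =>
    constructor
    · intro h
      obtain ⟨y, hy⟩ : ∃ y, y ≠ a := ⟨a + 1, by simp⟩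
      have h1 := sum_wordCone_pos q y
      rw [← h] at h1
      simp [wordCone, hy] at h1
    · rintro ⟨w, -, h⟩
      simp at h
  | cons d p ih =>
    rw [extends_cons_left, List.cons.injEq]
    by_cases hd : a = d
    · subst hd
      have : wordCone (a :: p) a = ∑ b, wordCone p b := by simp [wordCone]
      rw [this]
      simp only [ne_eq, not_true_eq_false, false_and, or_false, true_and]
      exact ⟨sum_wordCone_injective, fun h => by rw [h]⟩
    · have : wordCone (d :: p) a = wordCone p a := by simp [wordCone, hd]
      rw [this, ih]
      simp [Ne.symm hd]

theorem prox_iff {i j : Fin r} :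
    C.Prox j i ↔ ∃ a, Extends (· ≠ a) (C.word j) (a :: C.word i) := by
  simp only [Prox, v, cone_eq_wordCone, wordCone_eq_iff]
  refine ⟨And.right, fun h => ⟨?_, h⟩⟩
  rintro rfl
  exact not_extends_cons_self h.choose_spec

theorem inChain_iff {i j : Fin r} {a b : Fin 3} :
    C.inChain i a b j = true ↔ Extends (· = b) (C.word j) (a :: C.word i) := by
  suffices ∀ n, ∀ j : Fin r, (j : ℕ) = n →
      (C.inChain i a b j = true ↔ Extends (· = b) (C.word j) (a :: C.word i)) from this _ j rfl
  intro n
  induction n using Nat.strong_induction_on with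
  | _ n ih =>
    intro j hn
    by_cases hj : 0 < (j : ℕ)
    · rw [inChain, dif_pos hj, C.word_of_pos hj, extends_cons_left, List.cons.injEq,
        C.word_injective.eq_iff, ← ih _ (hn ▸ C.parent_lt j hj) _ rfl]
      simp [and_comm]
    · rw [inChain, dif_neg hj, C.word_of_not_pos hj]
      simp [Extends]

/-- The sum of `f` over the node with the given word (zero if there is none). -/
def nodeSum (f : Fin r → ℤ) (q : List (Fin 3)) : ℤ :=
  ∑ j, if C.word j = q then f j else 0

open Classical in
/-- The sum of `f` over the nodes whose word extends `q` by letters satisfying `P`. -/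
noncomputable def extSum (P : Fin 3 → Prop) (f : Fin r → ℤ) (q : List (Fin 3)) : ℤ :=
  ∑ j, if Extends P (C.word j) q then f j else 0

theorem nodeSum_word (f : Fin r → ℤ) (i : Fin r) : C.nodeSum f (C.word i) = f i := by
  simp [nodeSum, C.word_injective.eq_iff]

theorem nodeSum_eq_zero (f : Fin r → ℤ) {q : List (Fin 3)} (h : ∀ j, C.word j ≠ q) :
    C.nodeSum f q = 0 :=
  Finset.sum_eq_zero fun j _ => if_neg (h j)

theorem extSum_eq_zero (P : Fin 3 → Prop) (f : Fin r → ℤ) {q : List (Fin 3)}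
    (h : ∀ j, C.word j ≠ q) : C.extSum P f q = 0 := by
  refine Finset.sum_eq_zero fun j _ => if_neg ?_
  rintro ⟨w, -, hw⟩
  obtain ⟨k, hk⟩ := C.exists_word_eq_of_append w q hw
  exact h k hk

theorem extSum_eq (P : Fin 3 → Prop) [DecidablePred P] (f : Fin r → ℤ) (q : List (Fin 3)) :
    C.extSum P f q = C.nodeSum f q + ∑ d, if P d then C.extSum P f (d :: q) else 0 := by
  classical
  have h : (∑ d, if P d then C.extSum P f (d :: q) else 0) =
      ∑ j, ∑ d, if P d ∧ Extends P (C.word j) (d :: q) then f j else 0 := by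
    rw [Finset.sum_comm]
    refine Finset.sum_congr rfl fun d _ => ?_
    by_cases hd : P d <;> simp [hd, extSum]
  rw [h, extSum, nodeSum, ← Finset.sum_add_distrib]
  refine Finset.sum_congr rfl fun j _ => ?_
  by_cases hq : C.word j = q
  · have h0 : ∀ d, ¬ (P d ∧ Extends P (C.word j) (d :: q)) := by
      rintro d ⟨-, hd⟩
      rw [hq] at hd
      exact not_extends_cons_self hd
    rw [if_pos (extends_iff.2 (Or.inl hq)), if_pos hq,
      Finset.sum_eq_zero fun d _ => if_neg (h0 d), add_zero]
  · rw [if_neg hq, zero_add]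
    by_cases he : ∃ d, P d ∧ Extends P (C.word j) (d :: q)
    · rw [if_pos (extends_iff.2 (Or.inr he))]
      obtain ⟨d, hd, hx⟩ := he
      rw [Finset.sum_eq_single d, if_pos ⟨hd, hx⟩]
      · exact fun e _ hne => if_neg fun he => hne (he.2.label_unique hx)
      · simp
    · rw [if_neg (by rw [extends_iff]; exact not_or.2 ⟨hq, he⟩)]
      exact (Finset.sum_eq_zero fun d _ => if_neg fun hd => he ⟨d, hd⟩).symm

theorem extSum_nonneg (P : Fin 3 → Prop) {f : Fin r → ℤ} (hf : ∀ j, 0 ≤ f j)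
    (q : List (Fin 3)) : 0 ≤ C.extSum P f q :=
  Finset.sum_nonneg fun j _ => by split_ifs <;> simp [hf]

theorem nodeSum_nonneg {f : Fin r → ℤ} (hf : ∀ j, 0 ≤ f j) (q : List (Fin 3)) :
    0 ≤ C.nodeSum f q :=
  Finset.sum_nonneg fun j _ => by split_ifs <;> simp [hf]

theorem sum_fin_three {a b c : Fin 3} (hab : a ≠ b) (hac : a ≠ c) (hbc : b ≠ c)
    (f : Fin 3 → ℤ) : ∑ d, f d = f a + f b + f c := by
  rw [Fin.sum_univ_three]
  fin_cases a <;> fin_cases b <;> fin_cases c <;> simp_all <;> ring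

theorem extSum_eq_line (f : Fin r → ℤ) (b : Fin 3) (q : List (Fin 3)) :
    C.extSum (· = b) f q = C.nodeSum f q + C.extSum (· = b) f (b :: q) := by
  rw [extSum_eq]
  simp

theorem extSum_ne_eq {a b c : Fin 3} (hab : a ≠ b) (hac : a ≠ c) (hbc : b ≠ c)
    (f : Fin r → ℤ) (q : List (Fin 3)) :
    C.extSum (· ≠ a) f q =
      C.nodeSum f q + (C.extSum (· ≠ a) f (b :: q) + C.extSum (· ≠ a) f (c :: q)) := by
  rw [extSum_eq, sum_fin_three hab hac hbc]
  simp [hab.symm, hac.symm]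

/-- Induction from the leaves of a constellation to its root. -/
theorem word_induction {H : List (Fin 3) → Prop}
    (h0 : ∀ q, (∀ j, C.word j ≠ q) → H q) (h1 : ∀ q, (∀ d, H (d :: q)) → H q)
    (q : List (Fin 3)) : H q := by
  have hlen : ∀ j, (C.word j).length < ∑ i, ((C.word i).length + 1) := fun j =>
    lt_of_lt_of_le (Nat.lt_succ_self _)
      (Finset.single_le_sum (f := fun i => (C.word i).length + 1)
        (fun i _ => Nat.zero_le _) (mem_univ j))
  suffices ∀ n (q : List (Fin 3)), ∑ i, ((C.word i).length + 1) ≤ n + q.length → H q from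
    this _ q (Nat.le_add_right _ _)
  intro n
  induction n with
  | zero =>
    intro q hq
    refine h0 q fun j hj => ?_
    have := hlen j
    rw [hj] at this
    omega
  | succ n ih => exact fun q hq => h1 q fun d => ih _ (by simp only [List.length_cons]; omega)

end ToricConstellation

namespace ToricCluster

variable {r : ℕ} (A : ToricCluster r)

theorem eq_or_eq_or_eq : ∀ {a b c : Fin 3}, a ≠ b → a ≠ c → b ≠ c →
    ∀ d, d = a ∨ d = b ∨ d = c := by
  decide

theorem sum_ite_eq_of_unique {p : Fin 3 → Prop} [DecidablePred p] [Decidable (∃ a, p a)]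
    (h : ∀ a b, p a → p b → a = b) (x : ℤ) :
    (∑ a, if p a then x else 0) = if ∃ a, p a then x else 0 := by
  by_cases he : ∃ a, p a
  · rw [if_pos he]
    obtain ⟨a, ha⟩ := he
    rw [Finset.sum_eq_single a, if_pos ha]
    · exact fun b _ hb => if_neg fun hp => hb (h _ _ hp ha)
    · simp
  · rw [if_neg he]
    exact Finset.sum_eq_zero fun a _ => if_neg fun ha => he ⟨a, ha⟩

/-- The weight of the node with the given word (zero if there is none). -/
def weight (q : List (Fin 3)) : ℤ := A.nodeSum A.m q

/-- The sum of the weights along the chain of nodes starting at `q` with edges labelled `b`. -/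
noncomputable def line (b : Fin 3) (q : List (Fin 3)) : ℤ := A.extSum (· = b) A.m q

/-- The sum of the squared weights of the nodes above `q` reached without the label `a`. -/
noncomputable def squares (a : Fin 3) (q : List (Fin 3)) : ℤ :=
  A.extSum (· ≠ a) (fun j => A.m j ^ 2) q

/-- The number `r_{ab}` of a node, in terms of its word. -/
noncomputable def edge (a b : Fin 3) (q : List (Fin 3)) : ℤ :=
  A.weight q - A.line b (a :: q) - A.line a (b :: q)

theorem weight_word (i : Fin r) : A.weight (A.word i) = A.m i := A.nodeSum_word _ _

theorem weight_nonneg (q : List (Fin 3)) : 0 ≤ A.weight q :=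
  A.nodeSum_nonneg (fun j => (A.m_pos j).le) q

theorem line_nonneg (b : Fin 3) (q : List (Fin 3)) : 0 ≤ A.line b q :=
  A.extSum_nonneg _ (fun j => (A.m_pos j).le) q

theorem line_eq (b : Fin 3) (q : List (Fin 3)) :
    A.line b q = A.weight q + A.line b (b :: q) := A.extSum_eq_line _ _ _

theorem weight_le_line (b : Fin 3) (q : List (Fin 3)) : A.weight q ≤ A.line b q := by
  rw [line_eq]
  linarith [A.line_nonneg b (b :: q)]

theorem word_ne_of_weight_eq_zero {q : List (Fin 3)} (h : A.weight q = 0) (j : Fin r) :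
    A.word j ≠ q := by
  rintro rfl
  rw [weight_word] at h
  exact (A.m_pos j).ne' h

theorem exists_word_eq {q : List (Fin 3)} (h : A.weight q ≠ 0) : ∃ j, A.word j = q := by
  by_contra! hq
  exact h (A.nodeSum_eq_zero _ hq)

theorem line_eq_zero {q : List (Fin 3)} (h : A.weight q = 0) (b : Fin 3) : A.line b q = 0 :=
  A.extSum_eq_zero _ _ (A.word_ne_of_weight_eq_zero h)

theorem squares_eq {a b c : Fin 3} (hab : a ≠ b) (hac : a ≠ c) (hbc : b ≠ c)
    (q : List (Fin 3)) :
    A.squares a q = A.weight q ^ 2 + (A.squares a (b :: q) + A.squares a (c :: q)) := by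
  have h : A.nodeSum (fun j => A.m j ^ 2) q = A.weight q ^ 2 := by
    by_cases hq : ∃ j, A.word j = q
    · obtain ⟨j, rfl⟩ := hq
      rw [weight_word, A.nodeSum_word]
    · push Not at hq
      rw [weight, A.nodeSum_eq_zero _ hq, A.nodeSum_eq_zero _ hq]
      norm_num
  rw [← h]
  exact A.extSum_ne_eq hab hac hbc _ _

theorem sum_proxSet (f : Fin r → ℤ) (i : Fin r) :
    ∑ j ∈ A.proxSet i, f j = ∑ a, A.extSum (· ≠ a) f (a :: A.word i) := by
  classical
  simp only [extSum]
  rw [Finset.sum_comm, proxSet, Finset.sum_filter]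
  refine Finset.sum_congr rfl fun j _ => ?_
  rw [sum_ite_eq_of_unique fun a b ha hb => ha.label_unique hb]
  simp only [A.prox_iff]

open Classical in
theorem sum_Bset (f : Fin r → ℤ) (i : Fin r) :
    ∑ j ∈ A.Bset i, f j =
      ∑ a, ∑ j, if Extends (· ≠ a) (A.word i) (a :: A.word j) then f j else 0 := by
  rw [Finset.sum_comm, Bset, Finset.sum_filter]
  refine Finset.sum_congr rfl fun j _ => ?_
  rw [sum_ite_eq_of_unique fun a b ha hb => ha.label_unique hb]
  simp only [A.prox_iff]

theorem mem_iff_exists_extends {c : Fin 3} {i : Fin r} :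
    c ∈ A.word i ↔ ∃ j, Extends (· ≠ c) (A.word i) (c :: A.word j) := by
  constructor
  · intro h
    obtain ⟨w, q, hq, hw⟩ := List.eq_append_cons_of_mem h
    obtain ⟨k, hk⟩ := A.exists_word_eq_of_append w (c :: q) hq
    obtain ⟨-, -, hp⟩ := A.word_eq_cons hk
    exact ⟨A.parent k, w, fun y hy hyc => hw (hyc ▸ hy), hp ▸ hq⟩
  · rintro ⟨j, w, -, hw⟩
    simp [hw]

theorem extends_ne_unique {c : Fin 3} {p q q' : List (Fin 3)}
    (h : Extends (· ≠ c) p (c :: q)) (h' : Extends (· ≠ c) p (c :: q')) : q = q' := by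
  induction p with
  | nil =>
    obtain ⟨w, -, hw⟩ := h
    simp at hw
  | cons d p ih =>
    rw [extends_cons_left, List.cons.injEq] at h h'
    rcases h with ⟨h1, h2⟩ | ⟨h1, h2⟩ <;> rcases h' with ⟨h3, h4⟩ | ⟨h3, h4⟩
    · exact h2.symm.trans h4
    · exact absurd h1 h3
    · exact absurd h3 h1
    · exact ih h2 h4

open Classical in
theorem sum_extends_eq {c : Fin 3} {i : Fin r} {f : Fin r → ℤ} {x : ℤ}
    (hf : ∀ j, Extends (· ≠ c) (A.word i) (c :: A.word j) → f j = x) :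
    (∑ j, if Extends (· ≠ c) (A.word i) (c :: A.word j) then f j else 0) =
      if c ∈ A.word i then x else 0 := by
  by_cases hc : c ∈ A.word i
  · rw [if_pos hc]
    obtain ⟨j, hj⟩ := A.mem_iff_exists_extends.1 hc
    rw [Finset.sum_eq_single j, if_pos hj, hf j hj]
    · exact fun k _ hk => if_neg fun hk' => hk (A.word_injective (extends_ne_unique hk' hj))
    · simp
  · rw [if_neg hc]
    exact Finset.sum_eq_zero fun j _ =>
      if_neg fun hj => hc (A.mem_iff_exists_extends.2 ⟨j, hj⟩)

theorem sum_linProx {a b c : Fin 3} (hab : a ≠ b) (hac : a ≠ c) (hbc : b ≠ c) {i j : Fin r}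
    (hj : Extends (· ≠ c) (A.word j) (c :: A.word i)) :
    ∑ k ∈ (A.proxSet i).filter (fun k => A.LinProx k j), A.m k =
      A.line b (a :: A.word j) + A.line a (b :: A.word j) := by
  classical
  have key : ∀ k, (A.Prox k i ∧ A.LinProx k j) ↔
      (Extends (· = b) (A.word k) (a :: A.word j) ∨
        Extends (· = a) (A.word k) (b :: A.word j)) := by
    intro k
    obtain ⟨w, hw, hwj⟩ := hj
    have hall : ∀ y : Fin 3, y ≠ c → y = a ∨ y = b := fun y hy => by
      simpa [hy] using eq_or_eq_or_eq hab hac hbc y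
    simp only [A.prox_iff, LinProx, A.inChain_iff]
    constructor
    · rintro ⟨⟨c', w', hw', h'⟩, d, e, hde, u, hu, h⟩
      rw [h', hwj, ← List.cons_append, ← List.append_assoc] at h
      obtain ⟨rfl, rfl⟩ := append_cons_inj h
      rw [hwj, h']
      have hd := hall d (hw' d (by simp))
      have hy : ∀ y ∈ u, y = a ∨ y = b := fun y hy => hall y (hw' y (by simp [hy]))
      rcases hd with rfl | rfl
      · refine Or.inl ⟨u, fun y hyu => (hy y hyu).resolve_left ?_, by simp⟩
        rw [hu y hyu]
        exact hde.symm
      · refine Or.inr ⟨u, fun y hyu => (hy y hyu).resolve_right ?_, by simp⟩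
        rw [hu y hyu]
        exact hde.symm
    · rintro (⟨u, hu, h⟩ | ⟨u, hu, h⟩)
      · refine ⟨⟨c, u ++ a :: w, ?_, by simp [h, hwj]⟩, a, b, hab, u, hu, h⟩
        intro y hy
        rcases List.mem_append.1 hy with hy | hy
        · rw [hu y hy]
          exact hbc
        · rcases List.mem_cons.1 hy with rfl | hy
          · exact hac
          · exact hw y hy
      · refine ⟨⟨c, u ++ b :: w, ?_, by simp [h, hwj]⟩, b, a, hab.symm, u, hu, h⟩
        intro y hy
        rcases List.mem_append.1 hy with hy | hy
        · rw [hu y hy]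
          exact hac
        · rcases List.mem_cons.1 hy with rfl | hy
          · exact hbc
          · exact hw y hy
  rw [proxSet, Finset.filter_filter, Finset.sum_filter, line, line, extSum, extSum,
    ← Finset.sum_add_distrib]
  refine Finset.sum_congr rfl fun k _ => ?_
  simp only [key k]
  by_cases h1 : Extends (· = b) (A.word k) (a :: A.word j)
  · have h2 : ¬ Extends (· = a) (A.word k) (b :: A.word j) := fun h2 =>
      hab (h1.label_unique h2)
    simp [h1, h2]
  · simp [h1]

theorem extSum_line {a b c : Fin 3} (hab : a ≠ b) (hac : a ≠ c) (hbc : b ≠ c)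
    (q : List (Fin 3)) :
    A.extSum (· ≠ c) (fun j => A.line b (a :: A.word j) + A.line a (b :: A.word j)) q =
      2 * A.extSum (· ≠ c) A.m q - A.line a q - A.line b q := by
  induction q using A.word_induction with
  | h0 q hq =>
    rw [A.extSum_eq_zero _ _ hq, A.extSum_eq_zero _ _ hq, line, line,
      A.extSum_eq_zero _ _ hq, A.extSum_eq_zero _ _ hq]
    norm_num
  | h1 q ih =>
    have hn : A.nodeSum (fun j => A.line b (a :: A.word j) + A.line a (b :: A.word j)) q =
        A.line b (a :: q) + A.line a (b :: q) := by
      by_cases hq : ∃ j, A.word j = q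
      · obtain ⟨j, rfl⟩ := hq
        rw [A.nodeSum_word]
      · push Not at hq
        have hq' : ∀ d, ∀ j, A.word j ≠ d :: q := fun d j hj => hq _ (A.word_eq_cons hj).2.2
        rw [A.nodeSum_eq_zero _ hq, line, line, A.extSum_eq_zero _ _ (hq' a),
          A.extSum_eq_zero _ _ (hq' b), add_zero]
    rw [A.extSum_ne_eq hac.symm hbc.symm hab, A.extSum_ne_eq hac.symm hbc.symm hab A.m, hn,
      ih, ih, A.line_eq a q, A.line_eq b q, weight]
    ring

theorem extSum_sub_linProx {a b c : Fin 3} (hab : a ≠ b) (hac : a ≠ c) (hbc : b ≠ c)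
    (i : Fin r) :
    A.extSum (· ≠ c)
        (fun j => A.m j - ∑ k ∈ (A.proxSet i).filter (fun k => A.LinProx k j), A.m k)
        (c :: A.word i) =
      A.line a (c :: A.word i) + A.line b (c :: A.word i) -
        A.extSum (· ≠ c) A.m (c :: A.word i) := by
  classical
  have h := A.extSum_line hab hac hbc (c :: A.word i)
  have h' : A.extSum (· ≠ c)
        (fun j => A.m j - ∑ k ∈ (A.proxSet i).filter (fun k => A.LinProx k j), A.m k)
        (c :: A.word i) = A.extSum (· ≠ c) A.m (c :: A.word i) -
      A.extSum (· ≠ c) (fun j => A.line b (a :: A.word j) + A.line a (b :: A.word j))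
        (c :: A.word i) := by
    rw [extSum, extSum, extSum, ← Finset.sum_sub_distrib]
    refine Finset.sum_congr rfl fun j _ => ?_
    split_ifs with hj
    · rw [A.sum_linProx hab hac hbc hj]
    · simp
  rw [h', h]
  ring

theorem card_Aset (i : Fin r) :
    ((A.Aset i).card : ℤ) = ∑ d, if ∀ c ∈ A.word i, c = d then
      (if A.weight (d :: A.word i) = 0 then 0 else 1) else 0 := by
  classical
  have hp : ∀ k, (A.IsChild k i ∧ ¬ ∃ l, A.Prox i l ∧ A.Prox k l) ↔
      ∃ d, A.word k = d :: A.word i ∧ ∀ c ∈ A.word i, c = d := by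
    intro k
    have hchild : A.IsChild k i ↔ ∃ d, A.word k = d :: A.word i := by
      constructor
      · rintro ⟨h, hk⟩
        exact ⟨A.label k, by rw [A.word_of_pos h, hk]⟩
      · rintro ⟨d, hd⟩
        obtain ⟨h1, -, h3⟩ := A.word_eq_cons hd
        exact ⟨h1, A.word_injective h3⟩
    rw [hchild, ← exists_and_right]
    refine exists_congr fun d => and_congr_right fun hd => ?_
    rw [← not_iff_not, not_not]
    push Not
    constructor
    · rintro ⟨l, h1, h2⟩
      obtain ⟨c, w, hw, hi⟩ := A.prox_iff.1 h1
      obtain ⟨c', w', hw', hk⟩ := A.prox_iff.1 h2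
      rw [hd, hi, ← List.cons_append] at hk
      obtain ⟨rfl, rfl⟩ := append_cons_inj hk
      exact ⟨c, by simp [hi], (hw' d (by simp)).symm⟩
    · rintro ⟨c, hc, hcd⟩
      obtain ⟨l, hl⟩ := A.mem_iff_exists_extends.1 hc
      refine ⟨l, A.prox_iff.2 ⟨c, hl⟩, A.prox_iff.2 ⟨c, ?_⟩⟩
      rw [hd, extends_cons_left]
      exact Or.inr ⟨hcd.symm, hl⟩
  have hone : ∀ q, (if A.weight q = 0 then (0 : ℤ) else 1) = A.nodeSum (fun _ => 1) q := by
    intro q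
    by_cases hq : A.weight q = 0
    · rw [if_pos hq, A.nodeSum_eq_zero _ (A.word_ne_of_weight_eq_zero hq)]
    · rw [if_neg hq]
      obtain ⟨j, rfl⟩ := A.exists_word_eq hq
      rw [A.nodeSum_word]
  have hswap : (∑ d, if ∀ c ∈ A.word i, c = d then
      (if A.weight (d :: A.word i) = 0 then (0 : ℤ) else 1) else 0) =
      ∑ k, ∑ d, if A.word k = d :: A.word i ∧ ∀ c ∈ A.word i, c = d then 1 else 0 := by
    rw [Finset.sum_comm]
    refine Finset.sum_congr rfl fun d _ => ?_
    by_cases hd : ∀ c ∈ A.word i, c = d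
    · rw [if_pos hd, hone]
      exact Finset.sum_congr rfl fun k _ => by simp only [eq_true hd, and_true]
    · rw [if_neg hd]
      exact (Finset.sum_eq_zero fun k _ => if_neg fun h => hd h.2).symm
  rw [hswap, Aset, Finset.card_filter, Nat.cast_sum]
  refine Finset.sum_congr rfl fun k _ => ?_
  rw [sum_ite_eq_of_unique fun a b ha hb => (List.cons.inj (ha.1.symm.trans hb.1)).1]
  simp only [hp k]
  split_ifs <;> simp

/-- `0` if the label occurs in the word and `1` otherwise. -/
def absent (c : Fin 3) (q : List (Fin 3)) : ℤ := if c ∈ q then 0 else 1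

/-- `1` if there is no node with the given word and `0` otherwise. -/
def missing (q : List (Fin 3)) : ℤ := if A.weight q = 0 then 1 else 0

theorem chi_eq {a b c : Fin 3} (hab : a ≠ b) (hac : a ≠ c) (hbc : b ≠ c) (i : Fin r) :
    A.chi i = A.m i ^ 2 - A.squares a (a :: A.word i) - A.squares b (b :: A.word i)
        - A.squares c (c :: A.word i)
      - absent a (A.word i) * A.edge b c (A.word i)
      - absent b (A.word i) * A.edge a c (A.word i)
      - absent c (A.word i) * A.edge a b (A.word i)
      + absent a (A.word i) * absent b (A.word i) * A.missing (c :: A.word i)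
      + absent a (A.word i) * absent c (A.word i) * A.missing (b :: A.word i)
      + absent b (A.word i) * absent c (A.word i) * A.missing (a :: A.word i) := by
  classical
  have hs := @sum_fin_three a b c hab hac hbc
  have e1 : ∑ j ∈ A.proxSet i, A.m j * (A.m j - 1) =
      ∑ j ∈ A.proxSet i, A.m j ^ 2 - ∑ j ∈ A.proxSet i, A.m j := by
    rw [← Finset.sum_sub_distrib]
    exact Finset.sum_congr rfl fun j _ => by ring
  have hB : ∀ {a b c : Fin 3}, a ≠ b → a ≠ c → b ≠ c →
      (∑ j, if Extends (· ≠ c) (A.word i) (c :: A.word j) then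
        A.m i - ∑ k ∈ (A.proxSet j).filter (fun k => A.LinProx k i), A.m k else 0) =
      if c ∈ A.word i then A.edge a b (A.word i) else 0 := by
    intro a b c hab hac hbc
    refine A.sum_extends_eq fun j hj => ?_
    rw [A.sum_linProx hab hac hbc hj, edge, weight_word]
    ring
  have hcard : ((A.Bset i).card : ℤ) = ∑ d, if d ∈ A.word i then 1 else 0 := by
    rw [Finset.card_eq_sum_ones, Nat.cast_sum, A.sum_Bset]
    exact Finset.sum_congr rfl fun d _ => A.sum_extends_eq fun _ _ => rfl
  have hcases : ∀ p : Fin 3 → Prop, (∀ d, p d) ↔ p a ∧ p b ∧ p c := by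
    intro p
    refine ⟨fun h => ⟨h a, h b, h c⟩, fun ⟨ha, hb, hc⟩ d => ?_⟩
    rcases eq_or_eq_or_eq hab hac hbc d with rfl | rfl | rfl <;> assumption
  rw [chi, e1, A.sum_proxSet, A.sum_proxSet, A.sum_proxSet, A.sum_Bset, A.card_Aset,
    hs, hs, hs, hs, hs, A.extSum_sub_linProx hab hac hbc,
    A.extSum_sub_linProx hac hab hbc.symm, A.extSum_sub_linProx hbc hab.symm hac.symm,
    hB hab hac hbc, hB hac hab hbc.symm, hB hbc hab.symm hac.symm]
  rw [hs] at hcard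
  replace hcard : (A.Bset i).card = (if a ∈ A.word i then 1 else 0) +
      (if b ∈ A.word i then 1 else 0) + (if c ∈ A.word i then 1 else 0) := by
    zify
    exact hcard
  simp only [hcases (fun d => d ∈ A.word i → d = _), hab, hac, hbc, hab.symm, hac.symm,
    hbc.symm, squares, absent, missing, edge, weight_word]
  by_cases ha : a ∈ A.word i <;> by_cases hb : b ∈ A.word i <;> by_cases hc : c ∈ A.word i <;>
    simp only [ha, hb, hc, if_true, if_false] at hcard ⊢ <;> norm_num at hcard <;>
    simp [hcard, Nat.choose] <;> (try split_ifs) <;> ring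

end ToricCluster

/-- The inequalities satisfied by the data of one corner of a node: the weight `x` of the
child, the sums `p`, `q` along the two chains through it and the sum `s` of the squared
weights. -/
structure CornerBound (x p q s : ℤ) : Prop where
  nonneg : 0 ≤ x
  le_left : x ≤ p
  le_right : x ≤ q
  eq_zero : x = 0 → p = 0 ∧ q = 0
  le_max : s ≤ x * max p q

namespace CornerBound

variable {m x a₁ a₂ s y b₁ b₂ t z c₁ c₂ u : ℤ}

theorem le_mul (h : CornerBound x a₁ a₂ s) : s ≤ a₁ * a₂ := by
  obtain ⟨h0, h1, h2, -, h⟩ := h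
  rcases le_total a₁ a₂ with h3 | h3
  · rw [max_eq_right h3] at h
    nlinarith
  · rw [max_eq_left h3] at h
    nlinarith

theorem symm (h : CornerBound x a₁ a₂ s) : CornerBound x a₂ a₁ s :=
  ⟨h.nonneg, h.le_right, h.le_left, fun hx => (h.eq_zero hx).symm, max_comm a₁ a₂ ▸ h.le_max⟩

theorem _root_.mul_add_mul_add_mul_le_sq (ha₁ : 0 ≤ a₁) (ha₂ : 0 ≤ a₂) (hb₁ : 0 ≤ b₁)
    (hb₂ : 0 ≤ b₂) (hc₁ : 0 ≤ c₁) (hc₂ : 0 ≤ c₂) (hab : a₁ + b₁ ≤ m) (hac : a₂ + c₁ ≤ m)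
    (hbc : b₂ + c₂ ≤ m) : a₁ * a₂ + b₁ * b₂ + c₁ * c₂ ≤ m ^ 2 := by
  have h1 : b₁ * b₂ ≤ (m - a₁) * b₂ := by gcongr; linarith
  have h2 : c₁ * c₂ ≤ (m - a₂) * (m - b₂) := by gcongr <;> linarith
  nlinarith [mul_nonneg (mul_nonneg ha₁ ha₂) hb₂, mul_nonneg ha₁ (by linarith : 0 ≤ m - a₂),
    mul_nonneg ha₁ (by linarith : 0 ≤ m - b₂), mul_nonneg ha₂ hb₂,
    mul_nonneg ha₂ (by linarith : 0 ≤ m - a₁), mul_nonneg hb₂ (by linarith : 0 ≤ m - a₁),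
    mul_nonneg ha₂ (by linarith : 0 ≤ m - b₂), mul_nonneg hb₂ (by linarith : 0 ≤ m - a₂)]

theorem sum_le_sq (ha : CornerBound x a₁ a₂ s) (hb : CornerBound y b₁ b₂ t)
    (hc : CornerBound z c₁ c₂ u) (hab : a₁ + b₁ ≤ m) (hac : a₂ + c₁ ≤ m) (hbc : b₂ + c₂ ≤ m) :
    s + t + u ≤ m ^ 2 := by
  have := mul_add_mul_add_mul_le_sq (ha.nonneg.trans ha.le_left) (ha.nonneg.trans ha.le_right)
    (hb.nonneg.trans hb.le_left) (hb.nonneg.trans hb.le_right) (hc.nonneg.trans hc.le_left)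
    (hc.nonneg.trans hc.le_right) hab hac hbc
  linarith [ha.le_mul, hb.le_mul, hc.le_mul]

theorem edge_le_aux (ha : CornerBound x a₁ a₂ s) (hb : CornerBound y b₁ b₂ t)
    (hc : CornerBound z c₁ c₂ u) (hab : a₁ + b₁ ≤ m) (hac : a₂ + c₁ ≤ m) (hbc : b₂ + c₂ ≤ m)
    (hz : z < m) (h : c₂ ≤ c₁) : m - a₁ - b₁ ≤ m ^ 2 - s - t - u := by
  have h1 := ha.le_mul
  have h2 := hb.le_mul
  have h3 := hc.le_max
  rw [max_eq_left h] at h3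
  obtain ⟨ha0, ha1, ha2, -, -⟩ := ha
  obtain ⟨hb0, hb1, hb2, -, -⟩ := hb
  obtain ⟨hc0, hc1, hc2, -, -⟩ := hc
  have h4 : b₁ * b₂ ≤ b₁ * (m - z) := by gcongr <;> linarith
  have h5 : z * c₁ ≤ z * (m - a₂) := by gcongr; linarith
  suffices m - a₁ - b₁ ≤ m ^ 2 - a₁ * a₂ - b₁ * (m - z) - z * (m - a₂) by linarith
  rcases le_total z a₁ with hza | hza
  · have h6 : (a₁ - z) * a₂ ≤ (a₁ - z) * (m - z) := by gcongr; linarith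
    nlinarith [mul_nonneg (by linarith : 0 ≤ m - z - 1) (by linarith : 0 ≤ m - a₁ - b₁),
      mul_nonneg (by linarith : 0 ≤ m - z) hc0]
  · have h6 : 0 ≤ (z - a₁) * a₂ := mul_nonneg (by linarith) (by linarith)
    nlinarith [mul_nonneg (by linarith : 0 ≤ m - z - 1) (by linarith : 0 ≤ m - b₁)]

theorem edge_le (ha : CornerBound x a₁ a₂ s) (hb : CornerBound y b₁ b₂ t)
    (hc : CornerBound z c₁ c₂ u) (hab : a₁ + b₁ ≤ m) (hac : a₂ + c₁ ≤ m) (hbc : b₂ + c₂ ≤ m)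
    (hz : z < m) : m - a₁ - b₁ ≤ m ^ 2 - s - t - u := by
  rcases le_total c₂ c₁ with h | h
  · exact edge_le_aux ha hb hc hab hac hbc hz h
  · linarith [edge_le_aux hb ha hc.symm (by linarith) hbc hac hz h]

theorem two_edges_le (ha : CornerBound x a₁ a₂ s) (hb : CornerBound y b₁ b₂ t)
    (hc : CornerBound z c₁ c₂ u) (hab : a₁ + b₁ ≤ m) (hac : a₂ + c₁ ≤ m) (hbc : b₂ + c₂ ≤ m)
    (hy : y < m) (hz : z < m) :
    (m - a₁ - b₁) + (m - a₂ - c₁) ≤ m ^ 2 - s - t - u + if x = 0 then 1 else 0 := by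
  have hx : (0 : ℤ) ≤ if x = 0 then 1 else 0 := by split_ifs <;> norm_num
  rcases hab.eq_or_lt with h | hr
  · linarith [edge_le ha.symm hc hb hac hab (by linarith : c₂ + b₂ ≤ m) hy]
  rcases hac.eq_or_lt with h | hr'
  · linarith [edge_le ha hb hc hab hac hbc hz]
  have h1 := ha.le_mul
  have h2 := hb.le_mul
  have h3 := hc.le_mul
  obtain ⟨ha0, ha1, ha2, ha3, -⟩ := ha
  obtain ⟨hb0, hb1, hb2, -, -⟩ := hb
  obtain ⟨hc0, hc1, hc2, -, -⟩ := hc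
  obtain ⟨e, he⟩ : ∃ e, e = m - a₁ - b₁ := ⟨_, rfl⟩
  obtain ⟨e', he'⟩ : ∃ e', e' = m - a₂ - c₁ := ⟨_, rfl⟩
  have hb₁ : b₁ = m - a₁ - e := by linarith
  have hc₁ : c₁ = m - a₂ - e' := by linarith
  have hmin : min (m * (a₁ + e)) (m * (a₂ + e')) ≤ m ^ 2 - b₁ * b₂ - c₁ * c₂ := by
    have h4 : c₁ * c₂ ≤ c₁ * (m - b₂) := by gcongr <;> linarith
    rcases le_total b₁ c₁ with h | h
    · refine (min_le_right _ _).trans ?_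
      have : b₁ * b₂ ≤ c₁ * b₂ := by gcongr; linarith
      rw [hc₁] at *
      nlinarith
    · refine (min_le_left _ _).trans ?_
      have : c₁ * (m - b₂) ≤ b₁ * (m - b₂) := by gcongr; linarith
      rw [hb₁] at *
      nlinarith
  have hprod : (a₁ + e) * (a₂ + e') ≤ min (m * (a₁ + e)) (m * (a₂ + e')) := by
    refine le_min ?_ ?_
    · rw [mul_comm]
      gcongr <;> linarith
    · gcongr <;> linarith
  have e1 : 1 ≤ e := by linarith
  have e1' : 1 ≤ e' := by linarith
  rw [← he, ← he']
  split_ifs with hx0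
  · nlinarith [mul_nonneg (by linarith : 0 ≤ e - 1) (by linarith : 0 ≤ e' - 1),
      (ha3 hx0).1, (ha3 hx0).2]
  · have hx1 : 1 ≤ x := by omega
    nlinarith [mul_nonneg (by linarith : 0 ≤ e - 1) (by linarith : 0 ≤ e' - 1),
      mul_nonneg (by linarith : 0 ≤ a₁ - 1) (by linarith : 0 ≤ e' - 1),
      mul_nonneg (by linarith : 0 ≤ a₂ - 1) (by linarith : 0 ≤ e - 1)]

theorem three_edges_le (ha : CornerBound x a₁ a₂ s) (hb : CornerBound y b₁ b₂ t)
    (hc : CornerBound z c₁ c₂ u) (hab : a₁ + b₁ ≤ m) (hac : a₂ + c₁ ≤ m) (hbc : b₂ + c₂ ≤ m)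
    (hx : x < m) (hy : y < m) (hz : z < m) :
    (m - a₁ - b₁) + (m - a₂ - c₁) + (m - b₂ - c₂) ≤ m ^ 2 - s - t - u +
      ((if x = 0 then 1 else 0) + (if y = 0 then 1 else 0) + if z = 0 then 1 else 0) := by
  have hx' : (0 : ℤ) ≤ if x = 0 then 1 else 0 := by split_ifs <;> norm_num
  have hy' : (0 : ℤ) ≤ if y = 0 then 1 else 0 := by split_ifs <;> norm_num
  have hz' : (0 : ℤ) ≤ if z = 0 then 1 else 0 := by split_ifs <;> norm_num
  rcases hab.eq_or_lt with h | hr₁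
  · linarith [two_edges_le hc.symm hb.symm ha.symm (by linarith : c₂ + b₂ ≤ m)
      (by linarith : c₁ + a₂ ≤ m) (by linarith : b₁ + a₁ ≤ m) hy hx]
  rcases hac.eq_or_lt with h | hr₂
  · linarith [two_edges_le hb ha hc.symm (by linarith : b₁ + a₁ ≤ m) hbc hac hx hz]
  rcases hbc.eq_or_lt with h | hr₃
  · linarith [two_edges_le ha hb hc hab hac hbc hy hz]
  have aux : ∀ {x a₁ a₂ s : ℤ}, CornerBound x a₁ a₂ s →
      s ≤ max (a₁ - 1) 0 * max (a₂ - 1) 0 + a₁ + a₂ - 1 + if x = 0 then 1 else 0 := by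
    intro x a₁ a₂ s h
    have h1 := h.le_mul
    split_ifs with hx0
    · obtain ⟨rfl, rfl⟩ := h.eq_zero hx0
      simpa using h1
    · have h0 := h.nonneg
      have hx1 : 1 ≤ x := by omega
      rw [max_eq_left (by linarith [h.le_left]), max_eq_left (by linarith [h.le_right])]
      linarith
  have hm : 0 ≤ m - 2 ∨ m = 1 := by have := ha.nonneg; omega
  have h1 := aux ha
  have h2 := aux hb
  have h3 := aux hc
  have hA1 := ha.nonneg.trans ha.le_left
  have hA2 := ha.nonneg.trans ha.le_right
  have hB1 := hb.nonneg.trans hb.le_left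
  have hB2 := hb.nonneg.trans hb.le_right
  have hC1 := hc.nonneg.trans hc.le_left
  have hC2 := hc.nonneg.trans hc.le_right
  rcases hm with hm | rfl
  · have := mul_add_mul_add_mul_le_sq (m := m - 2) (le_max_right (a₁ - 1) 0)
      (le_max_right (a₂ - 1) 0) (le_max_right (b₁ - 1) 0) (le_max_right (b₂ - 1) 0)
      (le_max_right (c₁ - 1) 0) (le_max_right (c₂ - 1) 0) (by omega) (by omega) (by omega)
    nlinarith
  · rw [max_eq_right (by linarith), max_eq_right (by linarith)] at h1 h2 h3
    linarith

end CornerBound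

namespace ToricCluster

variable {r : ℕ} (A : ToricCluster r)

theorem M_eq (i : Fin r) (a b : Fin 3) : A.M i a b = A.line b (a :: A.word i) := by
  rw [M, line, extSum, Finset.sum_filter]
  exact Finset.sum_congr rfl fun j _ => by congr 1; rw [A.inChain_iff]

variable {A}

theorem Idealistic.line_add_line_le (hA : A.Idealistic) {a b : Fin 3} (hab : a ≠ b)
    (q : List (Fin 3)) : A.line b (a :: q) + A.line a (b :: q) ≤ A.weight q := by
  by_cases hq : A.weight q = 0
  · have h : ∀ d, A.weight (d :: q) = 0 := fun d => by
      by_contra hd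
      obtain ⟨j, hj⟩ := A.exists_word_eq hd
      exact A.word_ne_of_weight_eq_zero hq _ (A.word_eq_cons hj).2.2
    rw [A.line_eq_zero (h a), A.line_eq_zero (h b), hq, add_zero]
  · obtain ⟨i, rfl⟩ := A.exists_word_eq hq
    rw [weight_word, ← M_eq, ← M_eq]
    exact hA i a b hab

theorem Idealistic.squares_le (hA : A.Idealistic) {a b c : Fin 3} (hab : a ≠ b) (hac : a ≠ c)
    (hbc : b ≠ c) (q : List (Fin 3)) :
    A.squares a q ≤ A.weight q * max (A.line b q) (A.line c q) := by
  induction q using A.word_induction with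
  | h0 q hq =>
    have hw : A.weight q = 0 := A.nodeSum_eq_zero _ hq
    rw [hw, zero_mul, squares, A.extSum_eq_zero _ _ hq]
  | h1 q ih =>
    have h := hA.line_add_line_le hbc q
    have hx := A.weight_nonneg q
    have hsub : ∀ d, A.squares a (d :: q) ≤ A.line b (d :: q) * A.line c (d :: q) := fun d =>
      CornerBound.le_mul (x := A.weight (d :: q)) ⟨A.weight_nonneg _, A.weight_le_line _ _,
        A.weight_le_line _ _, fun h => ⟨A.line_eq_zero h b, A.line_eq_zero h c⟩, ih d⟩
    have hb := hsub b
    have hc := hsub c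
    rw [A.squares_eq hab hac hbc, A.line_eq b q, A.line_eq c q, max_add_add_left]
    have h1 : A.line b (b :: q) * A.line c (b :: q) ≤
        max (A.line b (b :: q)) (A.line c (c :: q)) * A.line c (b :: q) :=
      mul_le_mul_of_nonneg_right (le_max_left _ _) (A.line_nonneg _ _)
    have h2 : A.line c (c :: q) * A.line b (c :: q) ≤
        max (A.line b (b :: q)) (A.line c (c :: q)) * A.line b (c :: q) :=
      mul_le_mul_of_nonneg_right (le_max_right _ _) (A.line_nonneg _ _)
    have h3 := mul_le_mul_of_nonneg_left h
      ((A.line_nonneg b (b :: q)).trans (le_max_left _ (A.line c (c :: q))))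
    linarith

theorem Idealistic.cornerBound (hA : A.Idealistic) {a b c : Fin 3} (hab : a ≠ b) (hac : a ≠ c)
    (hbc : b ≠ c) (q : List (Fin 3)) :
    CornerBound (A.weight q) (A.line b q) (A.line c q) (A.squares a q) :=
  ⟨A.weight_nonneg _, A.weight_le_line _ _, A.weight_le_line _ _,
    fun h => ⟨A.line_eq_zero h b, A.line_eq_zero h c⟩, hA.squares_le hab hac hbc q⟩

theorem Idealistic.weight_cons_le (hA : A.Idealistic) (a : Fin 3) (q : List (Fin 3)) :
    A.weight (a :: q) ≤ A.weight q := by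
  have h : a ≠ a + 1 := by revert a; decide
  linarith [hA.line_add_line_le h q, A.weight_le_line (a + 1) (a :: q),
    A.line_nonneg a ((a + 1) :: q)]

theorem Idealistic.exists_weight_eq_of_chi_neg (hA : A.Idealistic) {i : Fin r}
    (h : A.chi i < 0) : ∃ c, c ∉ A.word i ∧ A.weight (c :: A.word i) = A.m i := by
  by_contra! hc
  have hlt : ∀ c, c ∉ A.word i → A.weight (c :: A.word i) < A.m i := fun c hci =>
    lt_of_le_of_ne (A.weight_word i ▸ hA.weight_cons_le c _) (hc c hci)
  have h01 : (0 : Fin 3) ≠ 1 := by decide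
  have h02 : (0 : Fin 3) ≠ 2 := by decide
  have h12 : (1 : Fin 3) ≠ 2 := by decide
  have ha := hA.cornerBound h01 h02 h12 (0 :: A.word i)
  have hb := hA.cornerBound h01.symm h12 h02 (1 :: A.word i)
  have hc := hA.cornerBound h02.symm h12.symm h01 (2 :: A.word i)
  have hab := hA.line_add_line_le h01 (A.word i)
  have hac := hA.line_add_line_le h02 (A.word i)
  have hbc := hA.line_add_line_le h12 (A.word i)
  rw [weight_word] at hab hac hbc
  rw [A.chi_eq h01 h02 h12] at h
  by_cases m0 : 0 ∈ A.word i <;> by_cases m1 : 1 ∈ A.word i <;> by_cases m2 : 2 ∈ A.word i <;>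
    simp only [m0, m1, m2, absent, missing, edge, weight_word, if_true, if_false] at h
  · linarith [CornerBound.sum_le_sq ha hb hc hab hac hbc]
  · linarith [CornerBound.edge_le ha hb hc hab hac hbc (hlt 2 m2)]
  · linarith [CornerBound.edge_le ha.symm hc hb hac hab ((add_comm _ _).trans_le hbc) (hlt 1 m1)]
  · linarith [CornerBound.two_edges_le ha hb hc hab hac hbc (hlt 1 m1) (hlt 2 m2)]
  · linarith [CornerBound.edge_le hb.symm hc.symm ha hbc ((add_comm _ _).trans_le hab)
      ((add_comm _ _).trans_le hac) (hlt 0 m0)]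
  · linarith [CornerBound.two_edges_le hb ha hc.symm ((add_comm _ _).trans_le hab) hbc hac
      (hlt 0 m0) (hlt 2 m2)]
  · linarith [CornerBound.two_edges_le hc.symm hb.symm ha.symm ((add_comm _ _).trans_le hbc)
      ((add_comm _ _).trans_le hac) ((add_comm _ _).trans_le hab) (hlt 1 m1) (hlt 0 m0)]
  · linarith [CornerBound.three_edges_le ha hb hc hab hac hbc (hlt 0 m0) (hlt 1 m1) (hlt 2 m2)]

theorem Idealistic.weight_eq_zero_of_full (hA : A.Idealistic) {c d : Fin 3} (hd : d ≠ c)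
    {q : List (Fin 3)} (h : A.weight (c :: q) = A.weight q) :
    A.weight (d :: q) = 0 ∧ A.weight (d :: c :: q) = 0 := by
  have h1 := hA.line_add_line_le hd.symm q
  have h2 := A.line_eq d (c :: q)
  constructor
  · linarith [A.weight_nonneg (d :: q), A.weight_le_line c (d :: q),
      A.line_nonneg d (d :: c :: q)]
  · linarith [A.weight_nonneg (d :: c :: q), A.weight_le_line d (d :: c :: q),
      A.line_nonneg c (d :: q)]

theorem absent_eq (c : Fin 3) (q : List (Fin 3)) : absent c q = 0 ∨ absent c q = 1 := by
  unfold absent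
  split_ifs <;> simp

theorem _root_.CornerBound.chain_end {m z u w s α β : ℤ} (h : CornerBound z u w s) (hu : u ≤ m)
    (hw : w ≤ m) (hz : z < m) (hα : α = 0 ∨ α = 1) (hβ : β = 0 ∨ β = 1) :
    m - α - β ≤ m ^ 2 - s - α * (m - w) - β * (m - u) + α * β * if z = 0 then 1 else 0 := by
  obtain ⟨h0, h1, h2, h3, h4⟩ := h
  have hm : s ≤ z * m := h4.trans (mul_le_mul_of_nonneg_left (max_le hu hw) h0)
  have hzm : 0 ≤ (m - z - 1) * (m - 1) := mul_nonneg (by linarith) (by linarith)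
  have key : α * (m - w) + β * (m - u) ≤ (α + β) * (m - z) := by
    rcases hα with rfl | rfl <;> rcases hβ with rfl | rfl <;> linarith
  by_cases hz0 : z = 0
  · subst hz0
    obtain ⟨rfl, rfl⟩ := h3 rfl
    rcases hα with rfl | rfl <;> rcases hβ with rfl | rfl <;> simp <;> nlinarith
  · have hz1 : 1 ≤ z := by omega
    rcases hα with rfl | rfl <;> rcases hβ with rfl | rfl <;> simp [hz0] <;> nlinarith

theorem Idealistic.chi_add_chi_nonneg (hA : A.Idealistic) {c : Fin 3} {i k : Fin r}
    (hci : c ∉ A.word i) (hi : A.weight (c :: A.word i) = A.m i)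
    (hk : Extends (· = c) (A.word k) (c :: A.word i)) (hm : A.m k = A.m i)
    (h0 : ∀ d ≠ c, A.weight (d :: A.word k) = 0) (hne : A.weight (c :: A.word k) ≠ A.m k) :
    0 ≤ A.chi i + A.chi k := by
  obtain ⟨a, b, hab, hac, hbc⟩ : ∃ a b, a ≠ b ∧ a ≠ c ∧ b ≠ c := by
    clear hci hi hk h0 hne
    revert c
    decide
  have hck : absent c (A.word k) = 0 := by
    obtain ⟨w, -, hw⟩ := hk
    simp [absent, hw]
  have hdk : ∀ d ≠ c, absent d (A.word k) = absent d (A.word i) := by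
    intro d hd
    obtain ⟨w, hw, hwk⟩ := hk
    have : d ∉ w := fun h => hd (hw d h)
    simp [absent, hwk, hd, this]
  have hci' : absent c (A.word i) = 1 := if_neg hci
  have hia := (hA.weight_eq_zero_of_full hac (hi.trans (A.weight_word i).symm)).1
  have hib := (hA.weight_eq_zero_of_full hbc (hi.trans (A.weight_word i).symm)).1
  have hpos := A.m_pos i
  have key : ∀ l : Fin r, A.weight (a :: A.word l) = 0 → A.weight (b :: A.word l) = 0 →
      CornerBound (A.weight (c :: A.word l)) (A.line a (c :: A.word l))
          (A.line b (c :: A.word l)) (A.squares c (c :: A.word l)) ∧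
        A.line a (c :: A.word l) ≤ A.m l ∧ A.line b (c :: A.word l) ≤ A.m l ∧
        A.chi l = A.m l ^ 2 - A.squares c (c :: A.word l)
          - absent a (A.word l) * (A.m l - A.line b (c :: A.word l))
          - absent b (A.word l) * (A.m l - A.line a (c :: A.word l))
          - absent c (A.word l) * A.m l
          + absent a (A.word l) * absent b (A.word l) * A.missing (c :: A.word l)
          + absent a (A.word l) * absent c (A.word l)
          + absent b (A.word l) * absent c (A.word l) := by
    intro l ha hb
    have h1 := hA.line_add_line_le hac (A.word l)
    have h2 := hA.line_add_line_le hbc (A.word l)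
    rw [A.line_eq_zero ha, zero_add, weight_word] at h1
    rw [A.line_eq_zero hb, zero_add, weight_word] at h2
    refine ⟨hA.cornerBound hac.symm hbc.symm hab _, h1, h2, ?_⟩
    have hsq : ∀ d : Fin 3, A.weight (d :: A.word l) = 0 →
        A.squares d (d :: A.word l) = 0 := fun d hd =>
      A.extSum_eq_zero _ _ (A.word_ne_of_weight_eq_zero hd)
    rw [A.chi_eq hab hac hbc, hsq a ha, hsq b hb]
    simp only [edge, missing, A.line_eq_zero ha, A.line_eq_zero hb, weight_word, ha, hb, if_true]
    ring
  obtain ⟨i1, i2, i3, i4⟩ := key i hia hib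
  obtain ⟨k1, k2, k3, k4⟩ := key k (h0 a hac) (h0 b hbc)
  have hz : A.weight (c :: A.word k) < A.m k :=
    lt_of_le_of_ne (A.weight_word k ▸ hA.weight_cons_le c _) hne
  have hend := k1.chain_end k2 k3 hz (absent_eq a (A.word i)) (absent_eq b (A.word i))
  have hmiss : A.missing (c :: A.word i) = 0 := if_neg (by rw [hi]; exact hpos.ne')
  have hline : ∀ d, A.m i ≤ A.line d (c :: A.word i) := fun d =>
    hi ▸ A.weight_le_line d _
  have hla := le_antisymm i2 (hline a)
  have hlb := le_antisymm i3 (hline b)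
  have hs := i1.le_max
  rw [hi, hla, hlb, max_self] at hs
  rw [hla, hlb, hci', hmiss] at i4
  rw [hck, hdk a hac, hdk b hbc, missing] at k4
  rw [i4, k4]
  linarith

variable (A)

theorem N_eq (i : Fin r) : A.N i = A.m i + ∑ j ∈ A.Bset i, A.N j := by
  have h : A.anteSet i = A.Bset i := by
    refine Finset.filter_congr fun j _ => and_iff_right_of_imp fun h => ?_
    obtain ⟨a, w, -, hw⟩ := A.prox_iff.1 h
    exact A.lt_of_word_eq_append hw
  rw [N, Finset.sum_attach, h]

theorem N_pos (i : Fin r) : 0 < A.N i := by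
  induction i using WellFoundedLT.induction with
  | ind i ih =>
    rw [N_eq]
    refine add_pos_of_pos_of_nonneg (A.m_pos i) (Finset.sum_nonneg fun j hj => (ih j ?_).le)
    obtain ⟨a, w, -, hw⟩ := A.prox_iff.1 (Finset.mem_filter.1 hj).2
    exact A.lt_of_word_eq_append hw

open Classical in
/-- The value of `N` at the node of which the entry `c` of the cone of `i` is the vector
(zero if that entry is a standard basis vector). -/
noncomputable def coneN (c : Fin 3) (i : Fin r) : ℤ :=
  ∑ j, if Extends (· ≠ c) (A.word i) (c :: A.word j) then A.N j else 0

theorem N_eq_sum_coneN (i : Fin r) : A.N i = A.m i + ∑ c, A.coneN c i := by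
  rw [N_eq, A.sum_Bset]
  rfl

variable {A}

theorem coneN_of_notMem {c : Fin 3} {i : Fin r} (h : c ∉ A.word i) : A.coneN c i = 0 :=
  Finset.sum_eq_zero fun j _ => if_neg fun hj => h (A.mem_iff_exists_extends.2 ⟨j, hj⟩)

theorem coneN_child_self {c : Fin 3} {i k : Fin r} (h : A.word k = c :: A.word i) :
    A.coneN c k = A.N i := by
  rw [coneN]
  simp [h, extends_cons_left, A.word_injective.eq_iff]

theorem coneN_child_of_ne {c d : Fin 3} {i k : Fin r} (h : A.word k = c :: A.word i)
    (hd : d ≠ c) : A.coneN d k = A.coneN d i := by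
  have key : ∀ j, Extends (· ≠ d) (A.word k) (d :: A.word j) ↔
      Extends (· ≠ d) (A.word i) (d :: A.word j) := fun j => by
    simp [h, extends_cons_left, hd.symm]
  exact Finset.sum_congr rfl fun j _ => by congr 1; exact propext (key j)

/-- `Continues A c i k` says that `k` lies on the chain of nodes of constant weight above `i`
with edges labelled `c`. -/
structure Continues (A : ToricCluster r) (c : Fin 3) (i k : Fin r) : Prop where
  weight_eq : A.m k = A.m i
  coneN_eq : ∀ d ≠ c, A.coneN d k = A.coneN d i
  exists_mul : ∃ s ≥ 1, A.N k = s * A.N i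

theorem Continues.child {c : Fin 3} {i p k : Fin r} (h : Continues A c i p)
    (hci : c ∉ A.word i) (hk : A.word k = c :: A.word p) (hm : A.m k = A.m p) :
    Continues A c i k ∧ ∃ s ≥ 2, A.N k = s * A.N i := by
  obtain ⟨a, b, hab, hac, hbc⟩ : ∃ a b, a ≠ b ∧ a ≠ c ∧ b ≠ c := by
    clear hci hk h
    revert c
    decide
  obtain ⟨s, hs, hN⟩ := h.exists_mul
  have hcone : ∀ d ≠ c, A.coneN d k = A.coneN d i := fun d hd =>
    (coneN_child_of_ne hk hd).trans (h.coneN_eq d hd)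
  have hNk : A.N k = (s + 1) * A.N i := by
    have h1 := A.N_eq_sum_coneN i
    have h2 := A.N_eq_sum_coneN k
    rw [sum_fin_three hab hac hbc, coneN_of_notMem hci] at h1
    rw [sum_fin_three hab hac hbc, coneN_child_self hk, hcone a hac, hcone b hbc, hN, hm,
      h.weight_eq] at h2
    linarith
  exact ⟨⟨hm.trans h.weight_eq, hcone, s + 1, by linarith, hNk⟩, s + 1, by linarith, hNk⟩

theorem Idealistic.exists_chain_end (hA : A.Idealistic) {c : Fin 3} {i : Fin r}
    (hci : c ∉ A.word i) (hi : A.weight (c :: A.word i) = A.m i) :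
    ∃ k, Extends (· = c) (A.word k) (c :: A.word i) ∧ 0 ≤ A.chi i + A.chi k ∧
      ∃ s ≥ 2, A.N k = s * A.N i := by
  classical
  have step : ∀ p, Continues A c i p → A.weight (c :: A.word p) = A.m p →
      ∃ k, A.word k = c :: A.word p ∧ (Continues A c i k ∧ ∃ s ≥ 2, A.N k = s * A.N i) ∧
        ∀ d ≠ c, A.weight (d :: A.word k) = 0 := by
    intro p hp hw
    obtain ⟨k, hk⟩ := A.exists_word_eq (q := c :: A.word p) (by rw [hw]; exact (A.m_pos p).ne')
    refine ⟨k, hk, hp.child hci hk ?_, fun d hd => ?_⟩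
    · rw [← weight_word, hk, hw]
    · rw [hk]
      exact (hA.weight_eq_zero_of_full hd (hw.trans (A.weight_word p).symm)).2
  let good : Finset (Fin r) := univ.filter fun k =>
    Extends (· = c) (A.word k) (c :: A.word i) ∧
      (Continues A c i k ∧ ∃ s ≥ 2, A.N k = s * A.N i) ∧ ∀ d ≠ c, A.weight (d :: A.word k) = 0
  have hgood : good.Nonempty := by
    obtain ⟨k, h1, h2⟩ := step i ⟨rfl, fun _ _ => rfl, 1, le_rfl, (one_mul _).symm⟩ hi
    exact ⟨k, Finset.mem_filter.2 ⟨mem_univ k, extends_iff.2 (Or.inl h1), h2⟩⟩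
  obtain ⟨k, hk, hmax⟩ := good.exists_max_image id hgood
  obtain ⟨h1, ⟨h2, h3⟩, h4⟩ := (Finset.mem_filter.1 hk).2
  refine ⟨k, h1, hA.chi_add_chi_nonneg hci hi h1 h2.weight_eq h4 fun hw => ?_, h3⟩
  obtain ⟨l, hl, hl'⟩ := step k h2 hw
  refine absurd (hmax l (Finset.mem_filter.2 ⟨mem_univ l, ?_, hl'⟩)) (not_le.2 ?_)
  · rw [hl, extends_cons_left]
    exact Or.inr ⟨rfl, h1⟩
  · exact A.lt_of_word_eq_append (w := []) hl

theorem extends_eq_unique {c c' : Fin 3} {p q q' : List (Fin 3)} (hc : c ∉ q) (hc' : c' ∉ q')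
    (h : Extends (· = c) p (c :: q)) (h' : Extends (· = c') p (c' :: q')) : q = q' := by
  induction p with
  | nil =>
    obtain ⟨w, -, hw⟩ := h
    simp at hw
  | cons d p ih =>
    rw [extends_cons_left, List.cons.injEq] at h h'
    rcases h with ⟨rfl, rfl⟩ | ⟨rfl, h⟩ <;> rcases h' with ⟨rfl, rfl⟩ | ⟨rfl, h'⟩
    · rfl
    · obtain ⟨w, -, hw⟩ := h'
      simp [hw] at hc
    · obtain ⟨w, -, hw⟩ := h
      simp [hw] at hc'
    · exact ih h h'

end ToricCluster

theorem stmt13 {r : ℕ} (A : ToricCluster r) (hA : A.Idealistic) (j : Fin r)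
    (hchi : 0 < A.chi j) :
    0 < ∑ i ∈ Finset.univ.filter (fun i => A.N j ∣ A.N i), A.chi i := by
  have hex : ∀ i, A.chi i < 0 → ∃ k, ∃ c, c ∉ A.word i ∧
      Extends (· = c) (A.word k) (c :: A.word i) ∧ 0 ≤ A.chi i + A.chi k ∧
      ∃ s ≥ 2, A.N k = s * A.N i := by
    intro i hi
    obtain ⟨c, hc, hw⟩ := hA.exists_weight_eq_of_chi_neg hi
    obtain ⟨k, hk⟩ := hA.exists_chain_end hc hw
    exact ⟨k, c, hc, hk⟩
  choose! κ lab hlab hext hadd s hs hN using hex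
  set F := Finset.univ.filter (fun i => A.N j ∣ A.N i) with hF
  have hinj : Set.InjOn κ (F.filter fun i => A.chi i < 0) := by
    intro i hi i' hi' h
    have hi := (Finset.mem_filter.1 hi).2
    have hi' := (Finset.mem_filter.1 hi').2
    exact A.word_injective
      (extends_eq_unique (hlab i hi) (hlab i' hi') (hext i hi) (h ▸ hext i' hi'))
  have hj : j ∉ (F.filter fun i => A.chi i < 0).image κ := by
    intro h
    obtain ⟨i, hi, rfl⟩ := Finset.mem_image.1 h
    obtain ⟨hiF, hi⟩ := Finset.mem_filter.1 hi
    have hle := Int.le_of_dvd (A.N_pos i) (Finset.mem_filter.1 hiF).2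
    rw [hN i hi] at hle
    nlinarith [A.N_pos i, hs i hi]
  have hsub : insert j ((F.filter fun i => A.chi i < 0).image κ) ⊆
      F.filter fun i => ¬ A.chi i < 0 := by
    refine Finset.insert_subset ?_ fun k hk => ?_
    · simp [hF, hchi.le]
    · obtain ⟨i, hi, rfl⟩ := Finset.mem_image.1 hk
      obtain ⟨hiF, hi⟩ := Finset.mem_filter.1 hi
      refine Finset.mem_filter.2 ⟨Finset.mem_filter.2 ⟨mem_univ _, ?_⟩, ?_⟩
      · rw [hN i hi]
        exact (Finset.mem_filter.1 hiF).2.mul_left _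
      · linarith [hadd i hi]
  have hle := Finset.sum_le_sum_of_subset_of_nonneg (f := A.chi) hsub
    fun i hi _ => not_lt.1 (Finset.mem_filter.1 hi).2
  rw [Finset.sum_insert hj, Finset.sum_image hinj] at hle
  have hpair : 0 ≤ ∑ i ∈ F.filter (fun i => A.chi i < 0), (A.chi i + A.chi (κ i)) :=
    Finset.sum_nonneg fun i hi => hadd i (Finset.mem_filter.1 hi).2
  rw [Finset.sum_add_distrib] at hpair
  rw [← Finset.sum_filter_add_sum_filter_not F (fun i => A.chi i < 0)]
  linarith
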